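/- Let a<b, α,β ∈ (0,1), γ ∈ [0,1], N ∈ ℕ, L ∈ C¹([a,b]×ℝ^{3N};ℝ), l ∈ {1,…,N}, y^a ∈ ℝ^N and y_i^b ∈ ℝ for i ≠ l. Suppose y ∈ D is a local minimizer of J(y) = ∫_a^b L[y](x) dx among all functions in D satisfying y(a)=y^a and y_i(b)=y_i^b for all i ≠ l (with y_l(b) free), and assume that for each i = 2,…,N+1 the function x ↦ ∂_{N+i}L[y](x) is continuously differentiable on [a,b] and x ↦ ∂_{2N+i}L[y](x) admits continuous Riemann–Liouville derivatives ₐD_x^β and ₓD_b^α on [a,b]. Then y satisfies the Euler–Lagrange equations ∂_iL[y](x) − (d/dx)∂_{N+i}L[y](x) + (D^{β,α}_{1−γ} ∂_{2N+i}L[y])(x) = 0 for i = 2,…,N+1 and all x ∈ [a,b], together with the transversality condition [ ∂_{N+l+1}L[y](x) + γ(ₓI_b^{1−α} ∂_{2N+l+1}L[y])(x) − (1−γ)(ₐI_x^{1−β} ∂_{2N+l+1}L[y])(x) ]_{x=b} = 0. -/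

import Mathlib

open MeasureTheory Set

noncomputable section

/-- Left Riemann–Liouville fractional integral of order `α` with lower limit `a`. -/
def leftRLI (a α : ℝ) (f : ℝ → ℝ) (x : ℝ) : ℝ :=
  (1 / Real.Gamma α) * ∫ t in a..x, (x - t) ^ (α - 1) * f t

/-- Right Riemann–Liouville fractional integral of order `α` with upper limit `b`. -/
def rightRLI (b α : ℝ) (f : ℝ → ℝ) (x : ℝ) : ℝ :=
  (1 / Real.Gamma α) * ∫ t in x..b, (t - x) ^ (α - 1) * f t

/-- Left Caputo fractional derivative of order `α`. -/
def caputoL (a α : ℝ) (f : ℝ → ℝ) (x : ℝ) : ℝ :=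
  (1 / Real.Gamma (1 - α)) * ∫ t in a..x, (x - t) ^ (-α) * deriv f t

/-- Right Caputo fractional derivative of order `α`. -/
def caputoR (b α : ℝ) (f : ℝ → ℝ) (x : ℝ) : ℝ :=
  (-1 / Real.Gamma (1 - α)) * ∫ t in x..b, (t - x) ^ (-α) * deriv f t

/-- Combined Caputo fractional derivative `^C D^{α,β}_γ`. -/
def combCaputo (a b α β γ : ℝ) (f : ℝ → ℝ) (x : ℝ) : ℝ :=
  γ * caputoL a α f x + (1 - γ) * caputoR b β f x

/-- Left Riemann–Liouville fractional derivative of order `α`. -/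
def leftRLD (a α : ℝ) (g : ℝ → ℝ) (x : ℝ) : ℝ :=
  (1 / Real.Gamma (1 - α)) * deriv (fun s => ∫ t in a..s, (s - t) ^ (-α) * g t) x

/-- Right Riemann–Liouville fractional derivative of order `α`. -/
def rightRLD (b α : ℝ) (g : ℝ → ℝ) (x : ℝ) : ℝ :=
  (-1 / Real.Gamma (1 - α)) * deriv (fun s => ∫ t in s..b, (t - s) ^ (-α) * g t) x

/-- Combined Riemann–Liouville derivative `D^{β,α}_{1-γ} = (1-γ) ₐD_x^β + γ ₓD_b^α`. -/
def combRLD (a b β α γ : ℝ) (g : ℝ → ℝ) (x : ℝ) : ℝ :=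
  (1 - γ) * leftRLD a β g x + γ * rightRLD b α g x

/-- Componentwise combined Caputo derivative of a vector-valued function. -/
def combCaputoVec (a b α β γ : ℝ) {N : ℕ} (y : ℝ → Fin N → ℝ) (x : ℝ) : Fin N → ℝ :=
  fun i => combCaputo a b α β γ (fun t => y t i) x

/-- The class `D`: `y'` and `^C D^{α,β}_γ y` exist and are continuous on `[a,b]`. -/
def MemD (a b α β γ : ℝ) {N : ℕ} (y : ℝ → Fin N → ℝ) : Prop :=
  (∀ x ∈ Icc a b, DifferentiableAt ℝ y x) ∧
  ContinuousOn (deriv y) (Icc a b) ∧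
  ContinuousOn (combCaputoVec a b α β γ y) (Icc a b)

/-- The norm `‖·‖_{1,∞}` on `D`. -/
def norm1inf (a b α β γ : ℝ) {N : ℕ} (y : ℝ → Fin N → ℝ) : ℝ :=
  sSup ((fun x => ‖y x‖) '' Icc a b) + sSup ((fun x => ‖deriv y x‖) '' Icc a b) +
    sSup ((fun x => ‖combCaputoVec a b α β γ y x‖) '' Icc a b)

/-- Partial derivative of `L` with respect to the `i`-th component of its second
(vector) argument, i.e. `∂_{i+2} L` in the paper's numbering (`i : Fin N` ↦ `i+2`). -/
def pY {N : ℕ} (L : ℝ → (Fin N → ℝ) → (Fin N → ℝ) → (Fin N → ℝ) → ℝ)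
    (x : ℝ) (u v w : Fin N → ℝ) (i : Fin N) : ℝ :=
  deriv (fun s => L x (Function.update u i s) v w) (u i)

/-- Partial derivative w.r.t. the `i`-th component of the third argument (`∂_{N+i+2} L`). -/
def pV {N : ℕ} (L : ℝ → (Fin N → ℝ) → (Fin N → ℝ) → (Fin N → ℝ) → ℝ)
    (x : ℝ) (u v w : Fin N → ℝ) (i : Fin N) : ℝ :=
  deriv (fun s => L x u (Function.update v i s) w) (v i)

/-- Partial derivative w.r.t. the `i`-th component of the fourth argument (`∂_{2N+i+2} L`). -/
def pW {N : ℕ} (L : ℝ → (Fin N → ℝ) → (Fin N → ℝ) → (Fin N → ℝ) → ℝ)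
    (x : ℝ) (u v w : Fin N → ℝ) (i : Fin N) : ℝ :=
  deriv (fun s => L x u v (Function.update w i s)) (w i)

/-- `L[y](x) = L(x, y(x), y'(x), ^C D^{α,β}_γ y(x))`. -/
def lagAlong (a b α β γ : ℝ) {N : ℕ} (L : ℝ → (Fin N → ℝ) → (Fin N → ℝ) → (Fin N → ℝ) → ℝ)
    (y : ℝ → Fin N → ℝ) (x : ℝ) : ℝ :=
  L x (y x) (deriv y x) (combCaputoVec a b α β γ y x)

def pYAlong (a b α β γ : ℝ) {N : ℕ} (L : ℝ → (Fin N → ℝ) → (Fin N → ℝ) → (Fin N → ℝ) → ℝ)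
    (y : ℝ → Fin N → ℝ) (i : Fin N) (x : ℝ) : ℝ :=
  pY L x (y x) (deriv y x) (combCaputoVec a b α β γ y x) i

def pVAlong (a b α β γ : ℝ) {N : ℕ} (L : ℝ → (Fin N → ℝ) → (Fin N → ℝ) → (Fin N → ℝ) → ℝ)
    (y : ℝ → Fin N → ℝ) (i : Fin N) (x : ℝ) : ℝ :=
  pV L x (y x) (deriv y x) (combCaputoVec a b α β γ y x) i

def pWAlong (a b α β γ : ℝ) {N : ℕ} (L : ℝ → (Fin N → ℝ) → (Fin N → ℝ) → (Fin N → ℝ) → ℝ)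
    (y : ℝ → Fin N → ℝ) (i : Fin N) (x : ℝ) : ℝ :=
  pW L x (y x) (deriv y x) (combCaputoVec a b α β γ y x) i

/-- `g` is continuously differentiable on `[a,b]`. -/
def ContDiffOn1 (a b : ℝ) (g : ℝ → ℝ) : Prop :=
  (∀ x ∈ Icc a b, DifferentiableAt ℝ g x) ∧ ContinuousOn (deriv g) (Icc a b)

/-- `g` admits a continuous left Riemann–Liouville derivative `ₐD_x^β` on `[a,b]`. -/
def HasContLeftRLD (a b β : ℝ) (g : ℝ → ℝ) : Prop :=
  (∀ x ∈ Icc a b, DifferentiableAt ℝ (fun s => ∫ t in a..s, (s - t) ^ (-β) * g t) x) ∧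
  ContinuousOn (leftRLD a β g) (Icc a b)

/-- `g` admits a continuous right Riemann–Liouville derivative `ₓD_b^α` on `[a,b]`. -/
def HasContRightRLD (a b α : ℝ) (g : ℝ → ℝ) : Prop :=
  (∀ x ∈ Icc a b, DifferentiableAt ℝ (fun s => ∫ t in s..b, (t - s) ^ (-α) * g t) x) ∧
  ContinuousOn (rightRLD b α g) (Icc a b)

/-- The functional `J(y) = ∫_a^b L[y](x) dx`. -/
def Jfun (a b α β γ : ℝ) {N : ℕ} (L : ℝ → (Fin N → ℝ) → (Fin N → ℝ) → (Fin N → ℝ) → ℝ)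
    (y : ℝ → Fin N → ℝ) : ℝ :=
  ∫ x in a..b, lagAlong a b α β γ L y x


lemma aux_ker_int {a α x : ℝ} (hα : α < 1) (hx : a ≤ x) {k : ℝ → ℝ} (hk : ContinuousOn k (Icc a x)) :
    IntervalIntegrable (fun t => (x - t) ^ (-α) * k t) volume a x := by
  have h1 : IntervalIntegrable (fun t : ℝ => t ^ (-α)) volume (x - a) (x - x) :=
    intervalIntegral.intervalIntegrable_rpow' (by linarith)
  have h2 := h1.comp_sub_left x
  simp only [sub_sub_cancel] at h2
  exact h2.mul_continuousOn (by rwa [uIcc_of_le hx])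

lemma aux_ker_int' {b α x : ℝ} (hα : α < 1) (hx : x ≤ b) {k : ℝ → ℝ} (hk : ContinuousOn k (Icc x b)) :
    IntervalIntegrable (fun t => (t - x) ^ (-α) * k t) volume x b := by
  have h1 : IntervalIntegrable (fun t : ℝ => t ^ (-α)) volume (x - x) (b - x) :=
    intervalIntegral.intervalIntegrable_rpow' (by linarith)
  have h2 := h1.comp_sub_right x
  simp only [sub_add_cancel] at h2
  exact h2.mul_continuousOn (by rwa [uIcc_of_le hx])

lemma aux_subst {a α x : ℝ} (hα : α < 1) (hx : a ≤ x) (k : ℝ → ℝ) :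
    ∫ t in a..x, (x - t) ^ (-α) * k t =
      (x - a) ^ (1 - α) * ∫ s in (0:ℝ)..1, s ^ (-α) * k (x - (x - a) * s) := by
  rcases hx.eq_or_lt with rfl | h
  · simp [Real.zero_rpow (by linarith : (1 - α) ≠ 0)]
  have h1 := intervalIntegral.smul_integral_comp_sub_mul (a := 0) (b := 1)
    (fun t => (x - t) ^ (-α) * k t) (x - a) x
  simp only [mul_one, mul_zero, sub_zero, sub_sub_cancel, smul_eq_mul] at h1
  rw [← h1, show (1 - α) = 1 + (-α) by ring, Real.rpow_add (by linarith), Real.rpow_one, mul_assoc]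
  congr 1
  rw [← intervalIntegral.integral_const_mul]
  apply intervalIntegral.integral_congr
  intro s hs
  rw [uIcc_of_le zero_le_one] at hs
  simp only
  rw [Real.mul_rpow (by linarith) hs.1]
  ring

lemma aux_cont {a b α : ℝ} (hα : α < 1) {k : ℝ → ℝ} (hk : Continuous k) :
    ContinuousOn (fun x => ∫ t in a..x, (x - t) ^ (-α) * k t) (Icc a b) := by
  have h1 : ContinuousOn (fun x => (x - a) ^ (1 - α) *
      ∫ s in (0:ℝ)..1, s ^ (-α) * k (x - (x - a) * s)) (Icc a b) := by
    apply ContinuousOn.mul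
    · apply Continuous.continuousOn
      exact (continuous_id.sub continuous_const).rpow_const (fun x => Or.inr (by linarith))
    · obtain ⟨C, hC⟩ := (isCompact_Icc (a := a) (b := b)).exists_bound_of_continuousOn hk.continuousOn
      intro x hx
      apply intervalIntegral.continuousWithinAt_of_dominated_interval
        (bound := fun s => s ^ (-α) * C)
      · refine Filter.Eventually.of_forall fun x => ?_
        apply Measurable.aestronglyMeasurable
        have := hk.measurable
        fun_prop
      · filter_upwards [self_mem_nhdsWithin] with x hx
        refine Filter.Eventually.of_forall fun s hs => ?_
        rw [uIoc_of_le zero_le_one] at hs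
        rw [norm_mul, Real.norm_of_nonneg (Real.rpow_nonneg hs.1.le _)]
        refine mul_le_mul_of_nonneg_left (hC _ ?_) (Real.rpow_nonneg hs.1.le _)
        constructor <;> nlinarith [hx.1, hx.2, hs.1, hs.2]
      · exact (intervalIntegral.intervalIntegrable_rpow' (by linarith)).mul_const C
      · refine Filter.Eventually.of_forall fun s hs => ?_
        apply Continuous.continuousWithinAt
        fun_prop
  exact h1.congr fun x hx => aux_subst hα hx.1 k

lemma aux_cont' {a b α : ℝ} (hα : α < 1) {k : ℝ → ℝ} (hk : Continuous k) :
    ContinuousOn (fun x => ∫ t in x..b, (t - x) ^ (-α) * k t) (Icc a b) := by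
  have h := aux_cont (a := -b) (b := -a) hα (hk.comp continuous_neg)
  have h2 : ContinuousOn (fun x : ℝ => -x) (Icc a b) := continuous_neg.continuousOn
  have h3 := h.comp h2 (fun x hx => ⟨neg_le_neg hx.2, neg_le_neg hx.1⟩)
  refine h3.congr fun x hx => ?_
  simp only [Function.comp]
  have := intervalIntegral.integral_comp_neg (a := -b) (b := -x) (fun t => (t - x) ^ (-α) * k t)
  simp only [neg_neg] at this
  rw [← this]
  congr 1
  ext t
  ring_nf

lemma aux_fubini {a b α : ℝ} (hα : α < 1) (hab : a ≤ b) {g k : ℝ → ℝ}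
    (hg : ContinuousOn g (Icc a b)) (hk : ContinuousOn k (Icc a b)) :
    ∫ x in a..b, g x * ∫ t in a..x, (x - t) ^ (-α) * k t =
      ∫ t in a..b, k t * ∫ x in t..b, (x - t) ^ (-α) * g x := by
  set f : ℝ → ℝ := indicator (Ioc 0 (b - a)) (fun u => u ^ (-α)) with hf
  set G : ℝ → ℝ := indicator (Ioc a b) g with hG
  set K : ℝ → ℝ := indicator (Ioc a b) k with hK
  have hfi : Integrable f := by
    rw [hf, integrable_indicator_iff measurableSet_Ioc]
    exact (intervalIntegrable_iff_integrableOn_Ioc_of_le (by linarith)).1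
      (intervalIntegral.intervalIntegrable_rpow' (by linarith))
  have hKi : Integrable K := by
    rw [hK, integrable_indicator_iff measurableSet_Ioc]
    exact (hk.integrableOn_Icc).mono_set Ioc_subset_Icc_self
  have hGi : Integrable G := by
    rw [hG, integrable_indicator_iff measurableSet_Ioc]
    exact (hg.integrableOn_Icc).mono_set Ioc_subset_Icc_self
  obtain ⟨C, hC⟩ := (isCompact_Icc (a := a) (b := b)).exists_bound_of_continuousOn hg
  have hC0 : 0 ≤ C := le_trans (norm_nonneg _) (hC a ⟨le_rfl, hab⟩)
  have hGb : ∀ x, ‖G x‖ ≤ C := by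
    intro x
    by_cases hx : x ∈ Ioc a b
    · rw [hG, indicator_of_mem hx]; exact hC x (Ioc_subset_Icc_self hx)
    · rw [hG, indicator_of_notMem hx]; simpa using hC0
  have hint : Integrable (Function.uncurry fun x t => G x * (K t * f (x - t)))
      ((volume : Measure ℝ).prod volume) := by
    have h1 := hKi.convolution_integrand (ContinuousLinearMap.mul ℝ ℝ) hfi
    exact h1.bdd_mul (f := fun p : ℝ × ℝ => G p.1) hGi.aestronglyMeasurable.comp_fst
      (Filter.Eventually.of_forall fun p => hGb p.1)
  have hsw := integral_integral_swap hint
  have e1 : ∫ x, ∫ t, G x * (K t * f (x - t)) =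
      ∫ x in a..b, g x * ∫ t in a..x, (x - t) ^ (-α) * k t := by
    rw [intervalIntegral.integral_of_le hab, ← integral_indicator measurableSet_Ioc]
    congr 1
    ext x
    rw [integral_const_mul]
    by_cases hx : x ∈ Ioc a b
    · rw [indicator_of_mem hx, hG, indicator_of_mem hx, intervalIntegral.integral_of_le hx.1.le,
        integral_Ioc_eq_integral_Ioo, ← integral_indicator measurableSet_Ioo]
      congr 2
      ext t
      by_cases ht : t ∈ Ioo a x
      · rw [indicator_of_mem ht, hK, indicator_of_mem (show t ∈ Ioc a b from ⟨ht.1, ht.2.le.trans hx.2⟩), hf,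
          indicator_of_mem (show x - t ∈ Ioc 0 (b - a) from ⟨by linarith [ht.2], by linarith [ht.1, hx.2]⟩)]
        ring
      · rw [indicator_of_notMem ht]
        by_cases ht1 : a < t
        · rw [hf, indicator_of_notMem, mul_zero]
          intro h
          exact ht ⟨ht1, by linarith [h.1]⟩
        · rw [hK, indicator_of_notMem (fun h => ht1 h.1), zero_mul]
    · rw [indicator_of_notMem hx, hG, indicator_of_notMem hx, zero_mul]
  have e2 : ∫ t, ∫ x, G x * (K t * f (x - t)) =
      ∫ t in a..b, k t * ∫ x in t..b, (x - t) ^ (-α) * g x := by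
    rw [intervalIntegral.integral_of_le hab, ← integral_indicator measurableSet_Ioc]
    congr 1
    ext t
    have : ∀ x, G x * (K t * f (x - t)) = K t * (f (x - t) * G x) := fun x => by ring
    simp_rw [this]
    rw [integral_const_mul]
    by_cases ht : t ∈ Ioc a b
    · rw [indicator_of_mem ht, hK, indicator_of_mem ht, intervalIntegral.integral_of_le ht.2,
        ← integral_indicator measurableSet_Ioc]
      congr 2
      ext x
      by_cases hx : x ∈ Ioc t b
      · rw [indicator_of_mem hx, hG, indicator_of_mem (show x ∈ Ioc a b from ⟨ht.1.trans hx.1, hx.2⟩), hf,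
          indicator_of_mem (show x - t ∈ Ioc 0 (b - a) from ⟨by linarith [hx.1], by linarith [ht.1, hx.2]⟩)]
      · rw [indicator_of_notMem hx]
        by_cases hx1 : x ≤ b
        · rw [hf, indicator_of_notMem, zero_mul]
          intro h
          exact hx ⟨by linarith [h.1], hx1⟩
        · rw [hG, indicator_of_notMem (fun h => hx1 h.2), mul_zero]
    · rw [indicator_of_notMem ht, hK, indicator_of_notMem ht, zero_mul]
  rw [← e1, ← e2, hsw]

lemma aux_deriv {E : Type*} [NormedAddCommGroup E] [NormedSpace ℝ E] {F : E → ℝ}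
    (hF : ContDiff ℝ 1 F) {a b : ℝ} (hab : a ≤ b) {p q : ℝ → E}
    (hp : ContinuousOn p (Icc a b)) (hq : ContinuousOn q (Icc a b)) :
    HasDerivAt (fun ε : ℝ => ∫ x in a..b, F (p x + ε • q x))
      (∫ x in a..b, fderiv ℝ F (p x) (q x)) 0 := by
  have hdF : Continuous (fderiv ℝ F) := hF.continuous_fderiv one_ne_zero
  have hc : ∀ ε : ℝ, ContinuousOn (fun x => p x + ε • q x) (Icc a b) := fun ε =>
    hp.add (hq.const_smul ε)
  have hcF : ∀ ε : ℝ, ContinuousOn (fun x => F (p x + ε • q x)) (Icc a b) := fun ε =>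
    hF.continuous.comp_continuousOn (hc ε)
  have hcF' : ∀ ε : ℝ, ContinuousOn (fun x => fderiv ℝ F (p x + ε • q x) (q x)) (Icc a b) := fun ε =>
    (hdF.comp_continuousOn (hc ε)).clm_apply hq
  have hj : ContinuousOn (fun z : ℝ × ℝ => fderiv ℝ F (p z.1 + z.2 • q z.1) (q z.1))
      (Icc a b ×ˢ Icc (-1) 1) := by
    have hp' : ContinuousOn (fun z : ℝ × ℝ => p z.1) (Icc a b ×ˢ Icc (-1) 1) :=
      hp.comp continuousOn_fst (fun z hz => hz.1)
    have hq' : ContinuousOn (fun z : ℝ × ℝ => q z.1) (Icc a b ×ˢ Icc (-1) 1) :=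
      hq.comp continuousOn_fst (fun z hz => hz.1)
    exact (hdF.comp_continuousOn (hp'.add (continuousOn_snd.smul hq'))).clm_apply hq'
  obtain ⟨C, hC⟩ := (isCompact_Icc.prod isCompact_Icc).exists_bound_of_continuousOn hj
  have hm : ∀ u : ℝ → ℝ, ContinuousOn u (Icc a b) →
      AEStronglyMeasurable u (volume.restrict (uIoc a b)) := by
    intro u hu
    rw [uIoc_of_le hab]
    exact (hu.mono Ioc_subset_Icc_self).aestronglyMeasurable measurableSet_Ioc
  have key := intervalIntegral.hasDerivAt_integral_of_dominated_loc_of_deriv_le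
    (F := fun ε x => F (p x + ε • q x)) (F' := fun ε x => fderiv ℝ F (p x + ε • q x) (q x))
    (x₀ := (0:ℝ)) (s := Icc (-1) 1) (bound := fun _ => C) (a := a) (b := b) (μ := volume)
    (Icc_mem_nhds (by norm_num) (by norm_num))
    (Filter.Eventually.of_forall fun ε => hm _ (hcF ε))
    ((hcF 0).intervalIntegrable_of_Icc hab) (hm _ (hcF' 0))
    (Filter.Eventually.of_forall fun x hx ε hε => by
      rw [uIoc_of_le hab] at hx
      exact hC (x, ε) ⟨Ioc_subset_Icc_self hx, hε⟩)
    intervalIntegrable_const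
    (Filter.Eventually.of_forall fun x hx ε hε => by
      have h1 : HasDerivAt (fun ε : ℝ => p x + ε • q x) (q x) ε := by
        simpa using ((hasDerivAt_id ε).smul_const (q x)).const_add (p x)
      exact ((hF.differentiable one_ne_zero _).hasFDerivAt).comp_hasDerivAt ε h1)
  simpa using key.2

lemma aux_caputo_cont {a b α β γ : ℝ} (hα : α < 1) (hβ : β < 1) {h : ℝ → ℝ}
    (hh : ContDiff ℝ 1 h) : ContinuousOn (combCaputo a b α β γ h) (Icc a b) := by
  have hd := hh.continuous_deriv le_rfl
  have h1 := aux_cont (a := a) (b := b) hα hd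
  have h2 := aux_cont' (a := a) (b := b) hβ hd
  unfold combCaputo caputoL caputoR
  exact (continuousOn_const.mul (continuousOn_const.mul h1)).add
    (continuousOn_const.mul (continuousOn_const.mul h2))

lemma aux_caputo_add {a b α β γ : ℝ} (hα : α < 1) (hβ : β < 1) {f h : ℝ → ℝ}
    (hf : ∀ x ∈ Icc a b, DifferentiableAt ℝ f x) (hf' : ContinuousOn (deriv f) (Icc a b))
    (hh : ContDiff ℝ 1 h) (ε : ℝ) {x : ℝ} (hx : x ∈ Icc a b) :
    combCaputo a b α β γ (fun t => f t + ε * h t) x =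
      combCaputo a b α β γ f x + ε * combCaputo a b α β γ h x := by
  have hd := hh.continuous_deriv le_rfl
  have hder : ∀ t ∈ Icc a b, deriv (fun t => f t + ε * h t) t = deriv f t + ε * deriv h t := by
    intro t ht
    exact ((hf t ht).hasDerivAt.add
      (((hh.differentiable one_ne_zero) t).hasDerivAt.const_mul ε)).deriv
  have s1 : Icc a x ⊆ Icc a b := Icc_subset_Icc le_rfl hx.2
  have s2 : Icc x b ⊆ Icc a b := Icc_subset_Icc hx.1 le_rfl
  have e1 : ∫ t in a..x, (x - t) ^ (-α) * deriv (fun t => f t + ε * h t) t =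
      (∫ t in a..x, (x - t) ^ (-α) * deriv f t) + ε * ∫ t in a..x, (x - t) ^ (-α) * deriv h t := by
    rw [← intervalIntegral.integral_const_mul, ← intervalIntegral.integral_add
      (aux_ker_int hα hx.1 (hf'.mono s1)) ((aux_ker_int hα hx.1 hd.continuousOn).const_mul ε)]
    apply intervalIntegral.integral_congr
    intro t ht
    rw [uIcc_of_le hx.1] at ht
    simp only
    rw [hder t (s1 ht)]
    ring
  have e2 : ∫ t in x..b, (t - x) ^ (-β) * deriv (fun t => f t + ε * h t) t =
      (∫ t in x..b, (t - x) ^ (-β) * deriv f t) + ε * ∫ t in x..b, (t - x) ^ (-β) * deriv h t := by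
    rw [← intervalIntegral.integral_const_mul, ← intervalIntegral.integral_add
      (aux_ker_int' hβ hx.2 (hf'.mono s2)) ((aux_ker_int' hβ hx.2 hd.continuousOn).const_mul ε)]
    apply intervalIntegral.integral_congr
    intro t ht
    rw [uIcc_of_le hx.2] at ht
    simp only
    rw [hder t (s2 ht)]
    ring
  unfold combCaputo caputoL caputoR
  rw [e1, e2]
  ring

/-- variation -/
def varD {N : ℕ} (i : Fin N) (h : ℝ → ℝ) (t : ℝ) : Fin N → ℝ := Pi.single i (h t)

lemma varD_hasDerivAt {N : ℕ} (i : Fin N) {h : ℝ → ℝ} (hh : ContDiff ℝ 1 h) (t : ℝ) :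
    HasDerivAt (varD i h) (Pi.single i (deriv h t)) t := by
  rw [hasDerivAt_pi]
  intro j
  have hd := ((hh.differentiable one_ne_zero) t).hasDerivAt
  unfold varD
  by_cases hj : j = i
  · subst hj; simpa using hd
  · simpa [Pi.single_eq_of_ne hj] using hasDerivAt_const t (0:ℝ)

lemma aux_single_cont {N : ℕ} (i : Fin N) {s : Set ℝ} {h : ℝ → ℝ} (hh : ContinuousOn h s) :
    ContinuousOn (fun x => (Pi.single i (h x) : Fin N → ℝ)) s :=
  (continuous_single (A := fun _ : Fin N => ℝ) i).comp_continuousOn hh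

lemma aux_vec_add {a b α β γ : ℝ} {N : ℕ} (hα : α < 1) (hβ : β < 1) {y : ℝ → Fin N → ℝ}
    (hy : MemD a b α β γ y) (i : Fin N) {h : ℝ → ℝ}
    (hh : ContDiff ℝ 1 h) (ε : ℝ) {x : ℝ} (hx : x ∈ Icc a b) :
    combCaputoVec a b α β γ (y + ε • varD i h) x =
      combCaputoVec a b α β γ y x + ε • Pi.single i (combCaputo a b α β γ h x) := by
  have hyd : ∀ j, ∀ x ∈ Icc a b, HasDerivAt (fun t => y t j) (deriv y x j) x := fun j x hx =>
    hasDerivAt_pi.1 (hy.1 x hx).hasDerivAt j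
  ext j
  by_cases hj : j = i
  · subst hj
    have := aux_caputo_add (γ := γ) hα hβ (f := fun t => y t j)
      (fun x hx => (hyd j x hx).differentiableAt)
      (((continuous_apply j).comp_continuousOn hy.2.1).congr fun x hx => (hyd j x hx).deriv) hh ε hx
    simpa [combCaputoVec, varD] using this
  · simp [combCaputoVec, varD, Pi.single_eq_of_ne hj]

lemma aux_deriv_add {a b α β γ : ℝ} {N : ℕ} {y : ℝ → Fin N → ℝ}
    (hy : MemD a b α β γ y) (i : Fin N) {h : ℝ → ℝ}
    (hh : ContDiff ℝ 1 h) (ε : ℝ) {x : ℝ} (hx : x ∈ Icc a b) :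
    HasDerivAt (y + ε • varD i h) (deriv y x + ε • Pi.single i (deriv h x)) x :=
  (hy.1 x hx).hasDerivAt.add ((varD_hasDerivAt i hh x).const_smul ε)

lemma aux_memD {a b α β γ : ℝ} {N : ℕ} (hα : α < 1) (hβ : β < 1) {y : ℝ → Fin N → ℝ}
    (hy : MemD a b α β γ y) (i : Fin N) {h : ℝ → ℝ}
    (hh : ContDiff ℝ 1 h) (ε : ℝ) : MemD a b α β γ (y + ε • varD i h) := by
  refine ⟨fun x hx => (aux_deriv_add hy i hh ε hx).differentiableAt, ?_, ?_⟩
  · refine ContinuousOn.congr ?_ fun x hx => (aux_deriv_add hy i hh ε hx).deriv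
    exact hy.2.1.add ((aux_single_cont i (hh.continuous_deriv le_rfl).continuousOn).const_smul ε)
  · refine ContinuousOn.congr ?_ fun x hx => aux_vec_add hα hβ hy i hh ε hx
    exact hy.2.2.add ((aux_single_cont i (aux_caputo_cont hα hβ hh)).const_smul ε)

lemma aux_memD_zero {a b α β γ : ℝ} {N : ℕ} : MemD a b α β γ (0 : ℝ → Fin N → ℝ) := by
  have h0 : deriv (0 : ℝ → Fin N → ℝ) = 0 := by
    ext x : 1
    exact deriv_const x (0 : Fin N → ℝ)
  have h1 : combCaputoVec a b α β γ (0 : ℝ → Fin N → ℝ) = 0 := by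
    ext x j
    simp [combCaputoVec, combCaputo, caputoL, caputoR]
  refine ⟨fun x _ => differentiableAt_const (0 : Fin N → ℝ), ?_, ?_⟩
  · rw [h0]; exact continuousOn_const (c := (0 : Fin N → ℝ))
  · rw [h1]; exact continuousOn_const (c := (0 : Fin N → ℝ))

lemma aux_norm {a b α β γ : ℝ} {N : ℕ} (hab : a ≤ b) (hα : α < 1) (hβ : β < 1)
    (i : Fin N) {h : ℝ → ℝ} (hh : ContDiff ℝ 1 h) :
    ∃ C : ℝ, ∀ ε : ℝ, norm1inf a b α β γ (ε • varD i h) ≤ |ε| * C := by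
  obtain ⟨C1, hC1⟩ := (isCompact_Icc (a := a) (b := b)).exists_bound_of_continuousOn
    hh.continuous.continuousOn
  obtain ⟨C2, hC2⟩ := (isCompact_Icc (a := a) (b := b)).exists_bound_of_continuousOn
    (hh.continuous_deriv le_rfl).continuousOn
  obtain ⟨C3, hC3⟩ := (isCompact_Icc (a := a) (b := b)).exists_bound_of_continuousOn
    (aux_caputo_cont (γ := γ) hα hβ hh)
  have hne : (Icc a b).Nonempty := ⟨a, le_rfl, hab⟩
  refine ⟨C1 + C2 + C3, fun ε => ?_⟩
  rw [mul_add, mul_add]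
  unfold norm1inf
  have z : (ε • varD i h) = 0 + ε • varD i h := (zero_add _).symm
  have key : ∀ (u : ℝ → Fin N → ℝ) (v : ℝ → ℝ) (C : ℝ), (∀ x ∈ Icc a b, ‖v x‖ ≤ C) →
      (∀ x ∈ Icc a b, u x = ε • Pi.single i (v x)) →
      sSup ((fun x => ‖u x‖) '' Icc a b) ≤ |ε| * C := by
    intro u v C hv hu
    apply csSup_le (hne.image _)
    rintro _ ⟨x, hx, rfl⟩
    simp only
    rw [hu x hx, norm_smul, Pi.norm_single, Real.norm_eq_abs]
    exact mul_le_mul_of_nonneg_left (hv x hx) (abs_nonneg ε)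
  refine add_le_add (add_le_add (key _ h C1 hC1 fun x hx => rfl) (key _ _ C2 hC2 fun x hx => ?_))
    (key _ _ C3 hC3 fun x hx => ?_)
  · exact ((varD_hasDerivAt i hh x).const_smul ε).deriv
  · rw [z, aux_vec_add hα hβ aux_memD_zero i hh ε hx]
    ext j
    simp [combCaputoVec, combCaputo, caputoL, caputoR]

lemma aux_first_var {a b α β γ : ℝ} {N : ℕ} (hab : a ≤ b) (hα : α < 1) (hβ : β < 1)
    {L : ℝ → (Fin N → ℝ) → (Fin N → ℝ) → (Fin N → ℝ) → ℝ}
    (hL : ContDiff ℝ 1 fun p : ℝ × (Fin N → ℝ) × (Fin N → ℝ) × (Fin N → ℝ) =>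
      L p.1 p.2.1 p.2.2.1 p.2.2.2)
    {l : Fin N} {ya yb : Fin N → ℝ} {y : ℝ → Fin N → ℝ}
    (hy : MemD a b α β γ y) (hya : y a = ya) (hyb : ∀ i : Fin N, i ≠ l → y b i = yb i)
    (hmin : ∃ δ > (0:ℝ), ∀ z : ℝ → Fin N → ℝ, MemD a b α β γ z →
      z a = ya → (∀ i : Fin N, i ≠ l → z b i = yb i) →
      norm1inf a b α β γ (z - y) < δ → Jfun a b α β γ L y ≤ Jfun a b α β γ L z)
    (i : Fin N) {h : ℝ → ℝ} (hh : ContDiff ℝ 1 h) (ha : h a = 0) (hb : i ≠ l → h b = 0) :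
    ∫ x in a..b, fderiv ℝ (fun p : ℝ × (Fin N → ℝ) × (Fin N → ℝ) × (Fin N → ℝ) =>
      L p.1 p.2.1 p.2.2.1 p.2.2.2) (x, y x, deriv y x, combCaputoVec a b α β γ y x)
      (0, Pi.single i (h x), Pi.single i (deriv h x), Pi.single i (combCaputo a b α β γ h x)) = 0 := by
  have hyc : ContinuousOn y (Icc a b) := fun x hx => (hy.1 x hx).continuousAt.continuousWithinAt
  have hder := aux_deriv hL hab
    (p := fun x => (x, y x, deriv y x, combCaputoVec a b α β γ y x))
    (q := fun x => (0, Pi.single i (h x), Pi.single i (deriv h x),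
      Pi.single i (combCaputo a b α β γ h x)))
    (continuousOn_id.prodMk (hyc.prodMk (hy.2.1.prodMk hy.2.2)))
    (continuousOn_const.prodMk ((aux_single_cont i hh.continuous.continuousOn).prodMk
      ((aux_single_cont i (hh.continuous_deriv le_rfl).continuousOn).prodMk
        (aux_single_cont i (aux_caputo_cont hα hβ hh)))))
  refine IsLocalMin.hasDerivAt_eq_zero ?_ hder
  have hJ : ∀ ε : ℝ, Jfun a b α β γ L (y + ε • varD i h) = ∫ x in a..b,
      (fun p : ℝ × (Fin N → ℝ) × (Fin N → ℝ) × (Fin N → ℝ) => L p.1 p.2.1 p.2.2.1 p.2.2.2)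
      ((x, y x, deriv y x, combCaputoVec a b α β γ y x) +
        ε • ((0 : ℝ), (Pi.single i (h x) : Fin N → ℝ), (Pi.single i (deriv h x) : Fin N → ℝ),
      (Pi.single i (combCaputo a b α β γ h x) : Fin N → ℝ))) := by
    intro ε
    unfold Jfun lagAlong
    apply intervalIntegral.integral_congr
    intro x hx
    rw [uIcc_of_le hab] at hx
    simp only
    rw [aux_vec_add hα hβ hy i hh ε hx, (aux_deriv_add hy i hh ε hx).deriv]
    simp [varD]
  obtain ⟨δ, hδ, hm⟩ := hmin
  obtain ⟨C, hC⟩ := aux_norm (γ := γ) hab hα hβ i hh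
  have hev : ∀ᶠ ε : ℝ in nhds 0, |ε| * C < δ := by
    have : Continuous fun ε : ℝ => |ε| * C := by fun_prop
    exact this.continuousAt.eventually_lt continuousAt_const (by simpa using hδ)
  filter_upwards [hev] with ε hε
  rw [← hJ, ← hJ]
  simp only [zero_smul, add_zero]
  refine hm _ (aux_memD hα hβ hy i hh ε) ?_ ?_ ?_
  · simp [varD, ha, hya]
  · intro j hj
    have : (Pi.single i (h b) : Fin N → ℝ) j = 0 := by
      by_cases hji : j = i
      · subst hji; simp [hb hj]
      · exact Pi.single_eq_of_ne hji _
    simp [varD, this, hyb j hj]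
  · rw [add_sub_cancel_left]
    exact (hC ε).trans_lt hε

lemma aux_pY {N : ℕ} {L : ℝ → (Fin N → ℝ) → (Fin N → ℝ) → (Fin N → ℝ) → ℝ}
    (hL : ContDiff ℝ 1 fun p : ℝ × (Fin N → ℝ) × (Fin N → ℝ) × (Fin N → ℝ) =>
      L p.1 p.2.1 p.2.2.1 p.2.2.2) (x : ℝ) (u v w : Fin N → ℝ) (i : Fin N) :
    pY L x u v w i = fderiv ℝ (fun p : ℝ × (Fin N → ℝ) × (Fin N → ℝ) × (Fin N → ℝ) =>
      L p.1 p.2.1 p.2.2.1 p.2.2.2) (x, u, v, w) (0, Pi.single i 1, 0, 0) := by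
  have h1 : HasDerivAt (fun s => (x, Function.update u i s, v, w)) (0, Pi.single i 1, 0, 0) (u i) :=
    (hasDerivAt_const _ _).prodMk ((hasDerivAt_update u i (u i)).prodMk
      ((hasDerivAt_const _ _).prodMk (hasDerivAt_const _ _)))
  have h2 := (hL.differentiable one_ne_zero (x, Function.update u i (u i), v, w)).hasFDerivAt
  have h3 := (h2.comp_hasDerivAt (u i) h1).deriv
  rw [Function.update_eq_self] at h3
  exact h3

lemma aux_pV {N : ℕ} {L : ℝ → (Fin N → ℝ) → (Fin N → ℝ) → (Fin N → ℝ) → ℝ}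
    (hL : ContDiff ℝ 1 fun p : ℝ × (Fin N → ℝ) × (Fin N → ℝ) × (Fin N → ℝ) =>
      L p.1 p.2.1 p.2.2.1 p.2.2.2) (x : ℝ) (u v w : Fin N → ℝ) (i : Fin N) :
    pV L x u v w i = fderiv ℝ (fun p : ℝ × (Fin N → ℝ) × (Fin N → ℝ) × (Fin N → ℝ) =>
      L p.1 p.2.1 p.2.2.1 p.2.2.2) (x, u, v, w) (0, 0, Pi.single i 1, 0) := by
  have h1 : HasDerivAt (fun s => (x, u, Function.update v i s, w)) (0, 0, Pi.single i 1, 0) (v i) :=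
    (hasDerivAt_const _ _).prodMk ((hasDerivAt_const _ _).prodMk
      ((hasDerivAt_update v i (v i)).prodMk (hasDerivAt_const _ _)))
  have h2 := (hL.differentiable one_ne_zero (x, u, Function.update v i (v i), w)).hasFDerivAt
  have h3 := (h2.comp_hasDerivAt (v i) h1).deriv
  rw [Function.update_eq_self] at h3
  exact h3

lemma aux_pW {N : ℕ} {L : ℝ → (Fin N → ℝ) → (Fin N → ℝ) → (Fin N → ℝ) → ℝ}
    (hL : ContDiff ℝ 1 fun p : ℝ × (Fin N → ℝ) × (Fin N → ℝ) × (Fin N → ℝ) =>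
      L p.1 p.2.1 p.2.2.1 p.2.2.2) (x : ℝ) (u v w : Fin N → ℝ) (i : Fin N) :
    pW L x u v w i = fderiv ℝ (fun p : ℝ × (Fin N → ℝ) × (Fin N → ℝ) × (Fin N → ℝ) =>
      L p.1 p.2.1 p.2.2.1 p.2.2.2) (x, u, v, w) (0, 0, 0, Pi.single i 1) := by
  have h1 : HasDerivAt (fun s => (x, u, v, Function.update w i s)) (0, 0, 0, Pi.single i 1) (w i) :=
    (hasDerivAt_const _ _).prodMk ((hasDerivAt_const _ _).prodMk
      ((hasDerivAt_const _ _).prodMk (hasDerivAt_update w i (w i))))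
  have h2 := (hL.differentiable one_ne_zero (x, u, v, Function.update w i (w i))).hasFDerivAt
  have h3 := (h2.comp_hasDerivAt (w i) h1).deriv
  rw [Function.update_eq_self] at h3
  exact h3

/-- Abstract scalar part: from the first variation formula to EL plus natural boundary term. -/
lemma aux_scalar {a b α β γ : ℝ} (hab : a < b) (hα : α < 1) (hβ : β < 1)
    {P V g : ℝ → ℝ} (hP : ContinuousOn P (Icc a b)) (hV : ContDiffOn1 a b V)
    (hg : ContinuousOn g (Icc a b)) (hgL : HasContLeftRLD a b β g) (hgR : HasContRightRLD a b α g)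
    {h : ℝ → ℝ} (hh : ContDiff ℝ 1 h) (ha : h a = 0)
    (h0 : ∫ x in a..b, (P x * h x + V x * deriv h x + g x * combCaputo a b α β γ h x) = 0) :
    (∫ x in a..b, (P x - deriv V x + combRLD a b β α γ g x) * h x) +
      (V b + γ * rightRLI b (1 - α) g b - (1 - γ) * leftRLI a (1 - β) g b) * h b = 0 := by
  have hd := hh.continuous_deriv le_rfl
  set R : ℝ → ℝ := fun s => ∫ t in s..b, (t - s) ^ (-α) * g t with hR
  set Lf : ℝ → ℝ := fun s => ∫ t in a..s, (s - t) ^ (-β) * g t with hLf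
  set cα : ℝ := 1 / Real.Gamma (1 - α) with hcα
  set cβ : ℝ := 1 / Real.Gamma (1 - β) with hcβ
  set M : ℝ → ℝ := fun s => V s + γ * (cα * R s) - (1 - γ) * (cβ * Lf s) with hM
  set M' : ℝ → ℝ := fun s => deriv V s - combRLD a b β α γ g s with hM'
  have hMd : ∀ x ∈ Icc a b, HasDerivAt M (M' x) x := by
    intro x hx
    have := ((hV.1 x hx).hasDerivAt.add (((hgR.1 x hx).hasDerivAt.const_mul cα).const_mul γ)).sub
      (((hgL.1 x hx).hasDerivAt.const_mul cβ).const_mul (1 - γ))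
    refine this.congr_deriv ?_
    simp only [hM', combRLD, leftRLD, rightRLD]
    rw [hcα, hcβ]
    ring
  have hM'c : ContinuousOn M' (Icc a b) := by
    refine hV.2.sub ?_
    exact (continuousOn_const.mul hgL.2).add (continuousOn_const.mul hgR.2)
  have hu : uIcc a b = Icc a b := uIcc_of_le hab.le
  have hii : ∀ {u : ℝ → ℝ}, ContinuousOn u (Icc a b) → IntervalIntegrable u volume a b :=
    fun hu => hu.intervalIntegrable_of_Icc hab.le
  have ibp := intervalIntegral.integral_mul_deriv_eq_deriv_mul (a := a) (b := b) (u := M) (v := h)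
    (u' := M') (v' := deriv h) (by rw [hu]; exact hMd)
    (fun x _ => (hh.differentiable one_ne_zero x).hasDerivAt) (hii hM'c) (hii hd.continuousOn)
  have hMb : M b = V b + γ * rightRLI b (1 - α) g b - (1 - γ) * leftRLI a (1 - β) g b := by
    simp [hM, hR, hLf, rightRLI, leftRLI, hcβ]
  have hRc : ContinuousOn R (Icc a b) := fun x hx =>
    (hgR.1 x hx).continuousAt.continuousWithinAt
  have hLc : ContinuousOn Lf (Icc a b) := fun x hx =>
    (hgL.1 x hx).continuousAt.continuousWithinAt
  have hVc : ContinuousOn V (Icc a b) := fun x hx =>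
    (hV.1 x hx).continuousAt.continuousWithinAt
  have f1 := aux_fubini hα hab.le hg hd.continuousOn
  have f2 := aux_fubini hβ hab.le hd.continuousOn hg
  have hc1 := aux_cont (a := a) (b := b) hα hd
  have hc2 := aux_cont' (a := a) (b := b) hβ hd
  have hhc : ContinuousOn h (Icc a b) := hh.continuous.continuousOn
  have hdc : ContinuousOn (deriv h) (Icc a b) := hd.continuousOn
  have i1 : IntervalIntegrable (fun x => P x * h x) volume a b := hii (hP.mul hhc)
  have i2 : IntervalIntegrable (fun x => V x * deriv h x) volume a b := hii (hVc.mul hdc)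
  have i3 : IntervalIntegrable (fun x => γ * cα * (g x * ∫ t in a..x, (x - t) ^ (-α) * deriv h t))
    volume a b := hii (continuousOn_const.mul (hg.mul hc1))
  have i4 : IntervalIntegrable (fun x => (1 - γ) * cβ * (g x * ∫ t in x..b, (t - x) ^ (-β) * deriv h t))
    volume a b := hii (continuousOn_const.mul (hg.mul hc2))
  have i5 : IntervalIntegrable (fun x => γ * cα * (deriv h x * R x))
    volume a b := hii (continuousOn_const.mul (hdc.mul hRc))
  have i6 : IntervalIntegrable (fun x => (1 - γ) * cβ * (deriv h x * Lf x))
    volume a b := hii (continuousOn_const.mul (hdc.mul hLc))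
  have i7 : IntervalIntegrable (fun x => M' x * h x) volume a b := hii (hM'c.mul hhc)
  have e1 : ∫ x in a..b, (P x * h x + V x * deriv h x + g x * combCaputo a b α β γ h x) =
      (∫ x in a..b, P x * h x) + (∫ x in a..b, V x * deriv h x) +
      (γ * cα * (∫ x in a..b, g x * ∫ t in a..x, (x - t) ^ (-α) * deriv h t) -
      (1 - γ) * cβ * (∫ x in a..b, g x * ∫ t in x..b, (t - x) ^ (-β) * deriv h t)) := by
    rw [← intervalIntegral.integral_const_mul, ← intervalIntegral.integral_const_mul,
      ← intervalIntegral.integral_sub i3 i4,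
      ← intervalIntegral.integral_add i1 i2,
      ← intervalIntegral.integral_add (i1.add i2) (i3.sub i4)]
    apply intervalIntegral.integral_congr
    intro x _
    simp only [combCaputo, caputoL, caputoR]
    rw [hcα, hcβ]
    ring
  have e2 : ∫ x in a..b, M x * deriv h x = (∫ x in a..b, V x * deriv h x) +
      (γ * cα * (∫ x in a..b, deriv h x * R x) - (1 - γ) * cβ * (∫ x in a..b, deriv h x * Lf x)) := by
    rw [← intervalIntegral.integral_const_mul, ← intervalIntegral.integral_const_mul,
      ← intervalIntegral.integral_sub i5 i6,
      ← intervalIntegral.integral_add i2 (i5.sub i6)]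
    apply intervalIntegral.integral_congr
    intro x _
    simp only [hM]
    ring
  have e3 : (∫ x in a..b, (P x - deriv V x + combRLD a b β α γ g x) * h x) =
      (∫ x in a..b, P x * h x) - ∫ x in a..b, M' x * h x := by
    rw [← intervalIntegral.integral_sub i1 i7]
    apply intervalIntegral.integral_congr
    intro x _
    simp only [hM']
    ring
  rw [e1, f1, ← f2] at h0
  rw [e3, ← hMb]
  rw [ha, e2] at ibp
  linarith

/-- Euler–Lagrange equations plus transversality condition when the terminal
value of the `l`-th component is free: at `x = b`,
`∂_{N+l+1}L[y] + γ ₓI_b^{1−α}∂_{2N+l+1}L[y] − (1−γ) ₐI_x^{1−β}∂_{2N+l+1}L[y] = 0`. -/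
theorem transversality_free_endpoint
    (a b α β γ : ℝ) (N : ℕ) (hab : a < b)
    (hα : α ∈ Ioo (0:ℝ) 1) (hβ : β ∈ Ioo (0:ℝ) 1) (hγ : γ ∈ Icc (0:ℝ) 1)
    (L : ℝ → (Fin N → ℝ) → (Fin N → ℝ) → (Fin N → ℝ) → ℝ)
    (hL : ContDiff ℝ 1 fun p : ℝ × (Fin N → ℝ) × (Fin N → ℝ) × (Fin N → ℝ) =>
      L p.1 p.2.1 p.2.2.1 p.2.2.2)
    (l : Fin N) (ya : Fin N → ℝ) (yb : Fin N → ℝ) (y : ℝ → Fin N → ℝ)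
    (hy : MemD a b α β γ y) (hya : y a = ya) (hyb : ∀ i : Fin N, i ≠ l → y b i = yb i)
    (hmin : ∃ δ > (0:ℝ), ∀ z : ℝ → Fin N → ℝ, MemD a b α β γ z →
      z a = ya → (∀ i : Fin N, i ≠ l → z b i = yb i) →
      norm1inf a b α β γ (z - y) < δ → Jfun a b α β γ L y ≤ Jfun a b α β γ L z)
    (hC1 : ∀ i : Fin N, ContDiffOn1 a b (pVAlong a b α β γ L y i))
    (hRL : ∀ i : Fin N, HasContLeftRLD a b β (pWAlong a b α β γ L y i) ∧
      HasContRightRLD a b α (pWAlong a b α β γ L y i)) :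
    (∀ i : Fin N, ∀ x ∈ Icc a b,
      pYAlong a b α β γ L y i x - deriv (pVAlong a b α β γ L y i) x
        + combRLD a b β α γ (pWAlong a b α β γ L y i) x = 0) ∧
    pVAlong a b α β γ L y l b + γ * rightRLI b (1 - α) (pWAlong a b α β γ L y l) b
      - (1 - γ) * leftRLI a (1 - β) (pWAlong a b α β γ L y l) b = 0 := by
  have hyc : ContinuousOn y (Icc a b) := fun x hx => (hy.1 x hx).continuousAt.continuousWithinAt
  have hdF := hL.continuous_fderiv one_ne_zero
  have hpc : ContinuousOn (fun x => (x, y x, deriv y x, combCaputoVec a b α β γ y x)) (Icc a b) :=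
    continuousOn_id.prodMk (hyc.prodMk (hy.2.1.prodMk hy.2.2))
  have hP : ∀ i, ContinuousOn (pYAlong a b α β γ L y i) (Icc a b) := fun i =>
    ((hdF.comp_continuousOn hpc).clm_apply continuousOn_const).congr
      fun x _ => aux_pY hL x _ _ _ i
  have hg : ∀ i, ContinuousOn (pWAlong a b α β γ L y i) (Icc a b) := fun i =>
    ((hdF.comp_continuousOn hpc).clm_apply continuousOn_const).congr
      fun x _ => aux_pW hL x _ _ _ i
  have main : ∀ (i : Fin N) (h : ℝ → ℝ), ContDiff ℝ 1 h → h a = 0 → (i ≠ l → h b = 0) →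
      (∫ x in a..b, (pYAlong a b α β γ L y i x - deriv (pVAlong a b α β γ L y i) x
        + combRLD a b β α γ (pWAlong a b α β γ L y i) x) * h x) +
      (pVAlong a b α β γ L y i b + γ * rightRLI b (1 - α) (pWAlong a b α β γ L y i) b
        - (1 - γ) * leftRLI a (1 - β) (pWAlong a b α β γ L y i) b) * h b = 0 := by
    intro i h hh ha hb
    refine aux_scalar hab hα.2 hβ.2 (hP i) (hC1 i) (hg i) (hRL i).1 (hRL i).2 hh ha ?_
    rw [← aux_first_var hab.le hα.2 hβ.2 hL hy hya hyb hmin i hh ha hb]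
    apply intervalIntegral.integral_congr
    intro x _
    simp only [pYAlong, pVAlong, pWAlong]
    rw [aux_pY hL, aux_pV hL, aux_pW hL]
    have hs : ∀ c : ℝ, (Pi.single i c : Fin N → ℝ) = c • Pi.single i 1 := by
      intro c
      ext j
      by_cases hj : j = i
      · subst hj; simp
      · simp [Pi.single_eq_of_ne hj]
    have hv : ((0 : ℝ), (Pi.single i (h x) : Fin N → ℝ), (Pi.single i (deriv h x) : Fin N → ℝ),
        (Pi.single i (combCaputo a b α β γ h x) : Fin N → ℝ)) =
        h x • ((0 : ℝ), (Pi.single i 1 : Fin N → ℝ), (0 : Fin N → ℝ), (0 : Fin N → ℝ)) +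
        deriv h x • ((0 : ℝ), (0 : Fin N → ℝ), (Pi.single i 1 : Fin N → ℝ), (0 : Fin N → ℝ)) +
        combCaputo a b α β γ h x •
          ((0 : ℝ), (0 : Fin N → ℝ), (0 : Fin N → ℝ), (Pi.single i 1 : Fin N → ℝ)) := by
      rw [hs (h x), hs (deriv h x), hs (combCaputo a b α β γ h x)]
      simp
    rw [hv, map_add, map_add, map_smul, map_smul, map_smul]
    simp only [smul_eq_mul]
    ring
  have hEc : ∀ i, ContinuousOn (fun x => pYAlong a b α β γ L y i x
      - deriv (pVAlong a b α β γ L y i) x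
      + combRLD a b β α γ (pWAlong a b α β γ L y i) x) (Icc a b) := fun i =>
    ((hP i).sub (hC1 i).2).add ((continuousOn_const.mul (hRL i).1.2).add
      (continuousOn_const.mul (hRL i).2.2))
  have EL : ∀ i : Fin N, ∀ x ∈ Icc a b,
      pYAlong a b α β γ L y i x - deriv (pVAlong a b α β γ L y i) x
        + combRLD a b β α γ (pWAlong a b α β γ L y i) x = 0 := by
    intro i
    set E : ℝ → ℝ := fun x => pYAlong a b α β γ L y i x - deriv (pVAlong a b α β γ L y i) x
        + combRLD a b β α γ (pWAlong a b α β γ L y i) x with hE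
    have hae : ∀ᵐ x, x ∈ Ioo a b → E x = 0 := by
      refine isOpen_Ioo.ae_eq_zero_of_integral_contDiff_smul_eq_zero ?_ ?_
      · exact ((hEc i).mono Ioo_subset_Icc_self).locallyIntegrableOn measurableSet_Ioo
      · intro h hh _ hsupp
        have hz : ∀ x, x ∉ Ioo a b → h x = 0 := fun x hx =>
          image_eq_zero_of_notMem_tsupport fun hx' => hx (hsupp hx')
        have h1 := main i h (hh.of_le (by exact_mod_cast le_top)) (hz a (by simp))
          (fun _ => hz b (by simp))
        rw [hz b (by simp), mul_zero, add_zero, intervalIntegral.integral_of_le hab.le] at h1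
        rw [← h1, ← integral_indicator measurableSet_Ioc]
        congr 1
        ext x
        by_cases hx : x ∈ Ioc a b
        · rw [indicator_of_mem hx, smul_eq_mul, mul_comm]
        · rw [indicator_of_notMem hx, hz x (fun h => hx ⟨h.1, h.2.le⟩), zero_smul]
    have hae' : E =ᵐ[volume.restrict (Icc a b)] 0 := by
      rw [← Measure.restrict_congr_set Ioo_ae_eq_Icc]
      exact (ae_restrict_iff' measurableSet_Ioo).2 hae
    exact Measure.eqOn_Icc_of_ae_eq volume hab.ne hae' (hEc i) continuousOn_const
  refine ⟨EL, ?_⟩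
  have h1 := main l (fun x => x - a) (by fun_prop) (by simp) (fun h => absurd rfl h)
  have h2 : (∫ x in a..b, (pYAlong a b α β γ L y l x - deriv (pVAlong a b α β γ L y l) x
        + combRLD a b β α γ (pWAlong a b α β γ L y l) x) * (x - a)) = 0 := by
    rw [intervalIntegral.integral_congr (g := fun _ => (0:ℝ))]
    · simp
    · intro x hx
      rw [uIcc_of_le hab.le] at hx
      simp only
      rw [EL l x hx, zero_mul]
  rw [h2, zero_add] at h1
  exact (mul_eq_zero.1 h1).resolve_right (by linarith)

end
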